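/- Let n ≥ 8 and let 𝒻 be a family of 3-element subsets of [n] that shatters no 3-element subset, with |𝒻| ≥ C(n−1, 2) + 2. Assume that every family of 3-element subsets of an (n−1)-element set that shatters no 3-element subset has size at most C(n−2, 2) + 1. Let W be a maximal witness assignment for 𝒻. Then for every x ∈ [n], there is at most one F ∈ 𝒻 with W(F) = {x}. -/

import Mathlib

/-- A family `𝒻` shatters a set `S` if every subset of `S` is the trace of some member of `𝒻`. -/
def Shatters (𝒻 : Finset (Finset ℕ)) (S : Finset ℕ) : Prop :=
  ∀ T ⊆ S, ∃ F ∈ 𝒻, F ∩ S = T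

/-- `W` is a maximal witness assignment for `𝒻`: for every `F ∈ 𝒻`, `W F` is a proper
subset of `F`, no `G ∈ 𝒻` satisfies `G ∩ F = W F`, and every strictly larger proper
subset of `F` is achieved as an intersection. -/
def MaximalWitness (𝒻 : Finset (Finset ℕ)) (W : Finset ℕ → Finset ℕ) : Prop :=
  ∀ F ∈ 𝒻, W F ⊂ F ∧ (∀ G ∈ 𝒻, G ∩ F ≠ W F) ∧
    ∀ B : Finset ℕ, B ⊂ F → (W F).card < B.card → ∃ G ∈ 𝒻, G ∩ F = B

open Finset hiding Shatters

theorem Shatters.of_traces {𝒻 : Finset (Finset ℕ)} {p q r : ℕ}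
    (h₀ : ∃ F ∈ 𝒻, p ∉ F ∧ q ∉ F ∧ r ∉ F) (h₁ : ∃ F ∈ 𝒻, p ∈ F ∧ q ∉ F ∧ r ∉ F)
    (h₂ : ∃ F ∈ 𝒻, p ∉ F ∧ q ∈ F ∧ r ∉ F) (h₃ : ∃ F ∈ 𝒻, p ∉ F ∧ q ∉ F ∧ r ∈ F)
    (h₄ : ∃ F ∈ 𝒻, p ∈ F ∧ q ∈ F ∧ r ∉ F) (h₅ : ∃ F ∈ 𝒻, p ∈ F ∧ q ∉ F ∧ r ∈ F)
    (h₆ : ∃ F ∈ 𝒻, p ∉ F ∧ q ∈ F ∧ r ∈ F) (h₇ : ∃ F ∈ 𝒻, p ∈ F ∧ q ∈ F ∧ r ∈ F) :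
    Shatters 𝒻 {p, q, r} := by
  intro T hT
  have key : ∃ F ∈ 𝒻, (p ∈ F ↔ p ∈ T) ∧ (q ∈ F ↔ q ∈ T) ∧ (r ∈ F ↔ r ∈ T) := by
    by_cases hp : p ∈ T <;> by_cases hq : q ∈ T <;> by_cases hr : r ∈ T <;>
      simp only [hp, hq, hr, iff_true, iff_false] <;> assumption
  obtain ⟨F, hF, h⟩ := key
  refine ⟨F, hF, ?_⟩
  ext u
  have := @hT u
  grind

theorem not_all_traces {V : Finset ℕ} {𝒻 : Finset (Finset ℕ)}
    (hns : ∀ S ⊆ V, #S = 3 → ¬ Shatters 𝒻 S) {p q r : ℕ} (hp : p ∈ V) (hq : q ∈ V) (hr : r ∈ V)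
    (hpq : p ≠ q) (hpr : p ≠ r) (hqr : q ≠ r)
    (h₀ : ∃ F ∈ 𝒻, p ∉ F ∧ q ∉ F ∧ r ∉ F) (h₁ : ∃ F ∈ 𝒻, p ∈ F ∧ q ∉ F ∧ r ∉ F)
    (h₂ : ∃ F ∈ 𝒻, p ∉ F ∧ q ∈ F ∧ r ∉ F) (h₃ : ∃ F ∈ 𝒻, p ∉ F ∧ q ∉ F ∧ r ∈ F)
    (h₄ : ∃ F ∈ 𝒻, p ∈ F ∧ q ∈ F ∧ r ∉ F) (h₅ : ∃ F ∈ 𝒻, p ∈ F ∧ q ∉ F ∧ r ∈ F)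
    (h₆ : ∃ F ∈ 𝒻, p ∉ F ∧ q ∈ F ∧ r ∈ F) (h₇ : ∃ F ∈ 𝒻, p ∈ F ∧ q ∈ F ∧ r ∈ F) : False :=
  hns {p, q, r} (by grind) (card_eq_three.2 ⟨p, q, r, hpq, hpr, hqr, rfl⟩)
    (.of_traces h₀ h₁ h₂ h₃ h₄ h₅ h₆ h₇)

theorem Finset.eq_triple_of_mem {F : Finset ℕ} (hF : F.card = 3) {u v w : ℕ} (hu : u ∈ F)
    (hv : v ∈ F) (hw : w ∈ F) (huv : u ≠ v) (huw : u ≠ w) (hvw : v ≠ w) : F = {u, v, w} := by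
  refine (eq_of_subset_of_card_le (by grind) ?_).symm
  rw [hF, card_eq_three.2 ⟨u, v, w, huv, huw, hvw, rfl⟩]

theorem Finset.exists_eq_triple {F : Finset ℕ} (hF : F.card = 3) {u v : ℕ} (hu : u ∈ F)
    (hv : v ∈ F) (huv : u ≠ v) : ∃ w, w ≠ u ∧ w ≠ v ∧ F = {u, v, w} := by
  obtain ⟨w, hw, hwuv⟩ := exists_mem_notMem_of_card_lt_card
    (show #{u, v} < #F by rw [card_pair huv, hF]; norm_num)
  have hwu : w ≠ u := by grind
  have hwv : w ≠ v := by grind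
  exact ⟨w, hwu, hwv, eq_triple_of_mem hF hu hv hw huv hwu.symm hwv.symm⟩

/-- If the sums of `f` over the members of `T` containing `A` vanish for every proper subset `A`
of `F`, then prescribing the trace of the members on `F` changes the sum over the members
containing `F` only by a sign. -/
theorem sum_superset_disjoint {T : Finset (Finset ℕ)} {f : Finset ℕ → ℚ} {F : Finset ℕ}
    (hvan : ∀ A ⊂ F, ∑ G ∈ T with A ⊆ G, f G = 0) (B : Finset ℕ) :
    ∀ A, Disjoint A B → A ∪ B ⊆ F → ∑ G ∈ T with A ⊆ G ∧ Disjoint G B, f G =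
      if A ∪ B = F then (-1) ^ #B * ∑ G ∈ T with F ⊆ G, f G else 0 := by
  induction B using Finset.induction with
  | empty =>
    intro A _ hA
    simp only [disjoint_empty_right, and_true, union_empty, card_empty, pow_zero, one_mul] at hA ⊢
    split_ifs with h
    · rw [h]
    · exact hvan A (hA.ssubset_of_ne h)
  | insert u B hu ih =>
    intro A hd hA
    have hd' : Disjoint A B := disjoint_of_subset_right (subset_insert _ _) hd
    have huA : u ∉ A := fun h ↦ disjoint_left.1 hd h (mem_insert_self _ _)
    have hd'' : Disjoint (insert u A) B := disjoint_insert_left.2 ⟨hu, hd'⟩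
    have hun : insert u A ∪ B = A ∪ insert u B := by grind
    have hsplit : ∑ G ∈ T with A ⊆ G ∧ Disjoint G B, f G =
        ∑ G ∈ T with insert u A ⊆ G ∧ Disjoint G B, f G +
          ∑ G ∈ T with A ⊆ G ∧ Disjoint G (insert u B), f G := by
      simp only [sum_filter, ← sum_add_distrib]
      refine sum_congr rfl fun G _ ↦ ?_
      simp only [insert_subset_iff, disjoint_insert_right]
      by_cases h : u ∈ G <;> simp [h]
    have hne : A ∪ B ≠ F := by
      rintro rfl
      have := hA (mem_union_right _ (mem_insert_self u B))
      grind
    rw [ih A hd' (by grind), ih _ hd'' (hun ▸ hA), if_neg hne, hun] at hsplit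
    rw [card_insert_of_notMem hu, pow_succ]
    split_ifs at hsplit ⊢ <;> linarith

theorem sum_superset_eq_zero {T : Finset (Finset ℕ)} {f : Finset ℕ → ℚ}
    (hT : ∀ F ∈ T, #F = 3) {k : ℕ} (hk : k < 3)
    (h : ∀ A, #A = k + 1 → ∑ G ∈ T with A ⊆ G, f G = 0) (A : Finset ℕ) (hA : #A = k) :
    ∑ G ∈ T with A ⊆ G, f G = 0 := by
  have h₀ : ∑ u ∈ T.sup id \ A, ∑ G ∈ T with insert u A ⊆ G, f G = 0 :=
    sum_eq_zero fun u hu ↦ h _ (by rw [card_insert_of_notMem (by grind), hA])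
  have h₁ : ∑ u ∈ T.sup id \ A, ∑ G ∈ T with insert u A ⊆ G, f G =
      (3 - k : ℚ) * ∑ G ∈ T with A ⊆ G, f G := by
    simp only [sum_filter]
    rw [sum_comm, mul_sum]
    refine sum_congr rfl fun G hG ↦ ?_
    rw [← sum_filter, sum_const]
    by_cases hAG : A ⊆ G
    · have : {u ∈ T.sup id \ A | insert u A ⊆ G} = G \ A := by
        ext u
        have : u ∈ G → u ∈ T.sup id := fun hu ↦ (le_sup (f := id) hG : G ⊆ T.sup id) hu
        simp only [insert_subset_iff, mem_filter, mem_sdiff]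
        tauto
      rw [this, card_sdiff_of_subset hAG, hT G hG, hA, if_pos hAG, nsmul_eq_mul,
        Nat.cast_sub hk.le]
      norm_num
    · simp [hAG, insert_subset_iff]
  rw [h₀] at h₁
  have : (3 - k : ℚ) ≠ 0 := by
    have : (k : ℚ) < 3 := by exact_mod_cast hk
    linarith
  exact (mul_eq_zero.1 h₁.symm).resolve_left this

/-- A family of triples shattering none of its members has at most as many members as the
collection of pairs contained in them. -/
theorem card_le_card_of_not_shatters {T P : Finset (Finset ℕ)} (hT : ∀ F ∈ T, #F = 3)
    (hP : ∀ F ∈ T, ∀ B ⊆ F, #B = 2 → B ∈ P) (hns : ∀ F ∈ T, ¬ Shatters T F) :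
    #T ≤ #P := by
  by_contra! hlt
  let L : (T → ℚ) →ₗ[ℚ] (P → ℚ) :=
    (Matrix.of fun (B : P) (G : T) ↦ if B.1 ⊆ G.1 then (1 : ℚ) else 0).mulVecLin
  have hker : LinearMap.ker L ≠ ⊥ := LinearMap.ker_ne_bot_of_finrank_lt (by simpa using hlt)
  obtain ⟨g, hg, hg0⟩ := (Submodule.ne_bot_iff _).1 hker
  obtain ⟨⟨F, hF⟩, hgF⟩ := Function.ne_iff.1 hg0
  let f : Finset ℕ → ℚ := fun G ↦ if h : G ∈ T then g ⟨G, h⟩ else 0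
  have h₂ : ∀ A, #A = 2 → ∑ G ∈ T with A ⊆ G, f G = 0 := by
    intro A hA
    by_cases hAP : A ∈ P
    · have := congrFun (LinearMap.mem_ker.1 hg) ⟨A, hAP⟩
      simp only [L, Matrix.mulVecLin_apply, Matrix.mulVec, dotProduct, Matrix.of_apply,
        ite_mul, one_mul, zero_mul, Pi.zero_apply] at this
      rw [sum_filter, ← sum_coe_sort]
      refine Eq.trans ?_ this
      exact sum_congr rfl fun G _ ↦ by simp [f]
    · rw [filter_false_of_mem fun G hG hAG ↦ hAP (hP G hG A hAG hA), sum_empty]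
  have h₁ := sum_superset_eq_zero hT (by norm_num : 1 < 3) h₂
  have h₀ := sum_superset_eq_zero hT (by norm_num : 0 < 3) h₁
  have hvan : ∀ A ⊂ F, ∑ G ∈ T with A ⊆ G, f G = 0 := by
    intro A hA
    have hlt := card_lt_card hA
    rw [hT F hF] at hlt
    interval_cases h : #A
    exacts [h₀ A h, h₁ A h, h₂ A h]
  have hself : ∑ G ∈ T with F ⊆ G, f G = f F := by
    have : {G ∈ T | F ⊆ G} = {F} := by
      ext G
      simp only [mem_filter, mem_singleton]
      refine ⟨fun h ↦ (eq_of_subset_of_card_le h.2 (by rw [hT _ h.1, hT F hF])).symm, ?_⟩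
      rintro rfl
      exact ⟨hF, subset_rfl⟩
    rw [this, sum_singleton]
  refine hns F hF fun C hC ↦ ?_
  have key := sum_superset_disjoint hvan (F \ C) C disjoint_sdiff (by grind)
  rw [if_pos (union_sdiff_of_subset hC), hself] at key
  have hfF : f F ≠ 0 := by simpa [f, hF] using hgF
  have hne : ∑ G ∈ T with C ⊆ G ∧ Disjoint G (F \ C), f G ≠ 0 := by
    rw [key]
    exact mul_ne_zero (by simp) hfF
  obtain ⟨G, hG, -⟩ := exists_ne_zero_of_sum_ne_zero hne
  obtain ⟨hGT, hCG, hGF⟩ := mem_filter.1 hG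
  refine ⟨G, hGT, ?_⟩
  ext u
  have h1 := @hC u
  have h2 := @hCG u
  have h3 : u ∈ G → u ∉ F \ C := fun h ↦ disjoint_left.1 hGF h
  grind

theorem star_of_degree {n : ℕ} {V : Finset ℕ} (hV : V.card = n) {𝒻 : Finset (Finset ℕ)}
    (hsub : ∀ F ∈ 𝒻, F ⊆ V) (hcard : ∀ F ∈ 𝒻, F.card = 3) {v w p q : ℕ} (hv : v ∈ V) (hw : w ∈ V)
    (hvw : v ≠ w) (hdeg : n - 1 ≤ #{F ∈ 𝒻 | v ∈ F})
    (hlink : ∀ F ∈ 𝒻, v ∈ F → w ∈ F ∨ F = {v, p, q}) :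
    {v, p, q} ∈ 𝒻 ∧ (∀ y ∈ V, y ≠ v → y ≠ w → {v, w, y} ∈ 𝒻) ∧ #{F ∈ 𝒻 | v ∈ F} = n - 1 := by
  have hss : {F ∈ 𝒻 | v ∈ F} ⊆
      insert {v, p, q} ((V \ {v, w}).image fun y ↦ ({v, w, y} : Finset ℕ)) := by
    intro F hF
    rw [mem_filter] at hF
    rcases hlink F hF.1 hF.2 with h | h
    · obtain ⟨y, h1, h2, rfl⟩ := exists_eq_triple (hcard F hF.1) hF.2 h hvw
      have := hsub _ hF.1 (show y ∈ _ by grind)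
      grind
    · grind
  have hle : #(insert {v, p, q} ((V \ {v, w}).image fun y ↦ ({v, w, y} : Finset ℕ))) ≤ n - 1 := by
    have h1 : #(V \ {v, w}) = n - 2 := by
      rw [card_sdiff_of_subset (by grind), card_pair hvw, hV]
    have h2 := card_insert_le ({v, p, q} : Finset ℕ)
      ((V \ {v, w}).image fun y ↦ ({v, w, y} : Finset ℕ))
    have h3 := card_image_le (s := V \ {v, w}) (f := fun y ↦ ({v, w, y} : Finset ℕ))
    have h4 : 2 ≤ n := by
      rw [← hV, ← card_pair hvw]; exact card_le_card (by grind)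
    omega
  have heq := eq_of_subset_of_card_le hss (hle.trans hdeg)
  have hmem : ∀ G, G ∈ insert {v, p, q} ((V \ {v, w}).image fun y ↦ ({v, w, y} : Finset ℕ)) →
      G ∈ 𝒻 := fun G hG ↦ (mem_filter.1 (heq ▸ hG)).1
  refine ⟨hmem _ (by simp), fun y hy h1 h2 ↦ hmem _ ?_, ?_⟩
  · refine mem_insert_of_mem (mem_image.2 ⟨y, by simp [hy, h1, h2], rfl⟩)
  · exact le_antisymm ((card_le_card hss).trans hle) hdeg
theorem exists_trace_of_degree {n : ℕ} (hn : 8 ≤ n) {V : Finset ℕ} (hV : #V = n)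
    {𝒻 : Finset (Finset ℕ)} (hsub : ∀ F ∈ 𝒻, F ⊆ V) (hcard : ∀ F ∈ 𝒻, #F = 3)
    {x a b c y z : ℕ} (hx : x ∈ V) (hb : b ∈ V) (hc : c ∈ V) (hy : y ∈ V)
    (hxb : x ≠ b) (hxc : x ≠ c) (hbc : b ≠ c)
    (hyx : y ≠ x) (hya : y ≠ a) (hyb : y ≠ b) (hyc : y ≠ c) (hxa : x ≠ a)
    (hyz : y ≠ z) (hzb : z ≠ b)
    (hdeg : n - 1 ≤ #{F ∈ 𝒻 | y ∈ F})
    (hlink : ∀ F ∈ 𝒻, x ∈ F → a ∈ F ∨ F = {x, b, c})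
    (hmeet : ∀ F ∈ 𝒻, x ∉ F → b ∈ F ∨ c ∈ F) :
    ∃ F ∈ 𝒻, b ∈ F ∧ y ∈ F ∧ z ∉ F := by
  by_contra! hno
  have hss : {F ∈ 𝒻 | y ∈ F} ⊆ insert {x, a, y} (insert {b, y, z}
      ((V \ {x, b, c, y}).image fun w ↦ ({c, y, w} : Finset ℕ))) := by
    intro F hF
    obtain ⟨hF, hyF⟩ := mem_filter.1 hF
    have hF3 := hcard F hF
    by_cases hxF : x ∈ F
    · rcases hlink F hF hxF with h | rfl
      · rw [eq_triple_of_mem hF3 hxF h hyF hxa hyx.symm hya.symm]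
        exact mem_insert_self _ _
      · grind
    by_cases hbF : b ∈ F
    · rw [eq_triple_of_mem hF3 hbF hyF (hno F hF hbF hyF) hyb.symm hzb.symm hyz]
      exact mem_insert_of_mem (mem_insert_self _ _)
    have hcF := (hmeet F hF hxF).resolve_left hbF
    obtain ⟨w, hwc, hwy, rfl⟩ := exists_eq_triple hF3 hcF hyF hyc.symm
    refine mem_insert_of_mem (mem_insert_of_mem (mem_image.2 ⟨w, ?_, rfl⟩))
    have := hsub _ hF (show w ∈ _ by simp)
    grind
  have h₁ : #(V \ {x, b, c, y}) = n - 4 := by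
    rw [card_sdiff_of_subset (by grind), hV, card_insert_of_notMem (by grind),
      card_eq_three.2 ⟨b, c, y, hbc, hyb.symm, hyc.symm, rfl⟩]
  have h₂ := card_le_card hss
  have h₃ := card_insert_le ({x, a, y} : Finset ℕ) (insert {b, y, z}
      ((V \ {x, b, c, y}).image fun w ↦ ({c, y, w} : Finset ℕ)))
  have h₄ := card_insert_le ({b, y, z} : Finset ℕ)
      ((V \ {x, b, c, y}).image fun w ↦ ({c, y, w} : Finset ℕ))
  have h₅ := card_image_le (s := V \ {x, b, c, y}) (f := fun w ↦ ({c, y, w} : Finset ℕ))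
  omega

set_option maxHeartbeats 1000000 in
theorem false_of_meets_pair {n : ℕ} (hn : 8 ≤ n) {V : Finset ℕ} (hV : #V = n)
    {𝒻 : Finset (Finset ℕ)} (hsub : ∀ F ∈ 𝒻, F ⊆ V) (hcard : ∀ F ∈ 𝒻, #F = 3)
    (hns : ∀ S ⊆ V, #S = 3 → ¬ Shatters 𝒻 S) (hdeg : ∀ v ∈ V, n - 1 ≤ #{F ∈ 𝒻 | v ∈ F})
    {x a b c : ℕ} (hx : x ∈ V) (ha : a ∈ V) (hb : b ∈ V) (hc : c ∈ V) (hxa : x ≠ a)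
    (hxb : x ≠ b) (hxc : x ≠ c) (hab : a ≠ b) (hac : a ≠ c) (hbc : b ≠ c)
    (hlink : ∀ F ∈ 𝒻, x ∈ F → a ∈ F ∨ F = {x, b, c})
    (hstar : ∀ y ∈ V, y ≠ x → y ≠ a → {x, a, y} ∈ 𝒻)
    (hmeet : ∀ F ∈ 𝒻, x ∉ F → b ∈ F ∨ c ∈ F) : False := by
  obtain ⟨R, hR⟩ : ∃ R, R = V \ {x, a, b, c} := ⟨_, rfl⟩
  have hRmem : ∀ y ∈ R, y ∈ V ∧ y ≠ x ∧ y ≠ a ∧ y ≠ b ∧ y ≠ c := by grind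
  have hmemR : ∀ y ∈ V, y ≠ x → y ≠ a → y ≠ b → y ≠ c → y ∈ R := by grind
  have hRcard : #R = n - 4 := by
    rw [hR, card_sdiff_of_subset (by simp [insert_subset_iff, hx, ha, hb, hc]), hV,
      card_insert_of_notMem (by simp [hxa, hxb, hxc]),
      card_eq_three.2 ⟨a, b, c, hab, hac, hbc, rfl⟩]
  have hdisj : ∀ y ∈ R, ∀ z ∈ R, y ≠ z → {b, y, z} ∈ 𝒻 → {c, y, z} ∉ 𝒻 := by
    intro y hy z hz hyz hbyz hcyz
    obtain ⟨hyV, hyx, hya, hyb, hyc⟩ := hRmem y hy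
    obtain ⟨hzV, hzx, hza, hzb, hzc⟩ := hRmem z hz
    have h₁ := exists_trace_of_degree hn hV hsub hcard hx hb hc hyV hxb hxc hbc hyx hya hyb hyc
      hxa hyz hzb (hdeg y hyV) hlink hmeet
    have h₂ := exists_trace_of_degree hn hV hsub hcard hx hb hc hzV hxb hxc hbc hzx hza hzb hzc
      hxa hyz.symm hyb (hdeg z hzV) hlink hmeet
    refine not_all_traces hns hb hyV hzV hyb.symm hzb.symm hyz
      ⟨_, hstar c hc hxc.symm hac.symm, ?_⟩ ⟨_, hstar b hb hxb.symm hab.symm, ?_⟩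
      ⟨_, hstar y hyV hyx hya, ?_⟩ ⟨_, hstar z hzV hzx hza, ?_⟩ h₁ (by grind)
      ⟨_, hcyz, ?_⟩ ⟨_, hbyz, ?_⟩ <;>
      clear hns hdeg hsub hcard hlink hstar hmeet hRmem hmemR hbyz hcyz <;> grind
  have hfull : ∀ y ∈ R, {a, b, y} ∈ 𝒻 ∧ {a, c, y} ∈ 𝒻 ∧ {b, c, y} ∈ 𝒻 ∧
      ∀ z ∈ R, z ≠ y → {b, y, z} ∈ 𝒻 ∨ {c, y, z} ∈ 𝒻 := by
    intro y hy
    obtain ⟨hyV, hyx, hya, hyb, hyc⟩ := hRmem y hy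
    let e : ℕ → Finset ℕ := fun z ↦ if {b, y, z} ∈ 𝒻 then {b, y, z} else {c, y, z}
    let Y : Finset (Finset ℕ) := {{x, a, y}, {a, b, y}, {a, c, y}, {b, c, y}}
    have hss : {F ∈ 𝒻 | y ∈ F} ⊆ Y ∪ (R.erase y).image e := by
      intro F hF
      obtain ⟨hF, hyF⟩ := mem_filter.1 hF
      have hF3 := hcard F hF
      by_cases hxF : x ∈ F
      · rcases hlink F hF hxF with h | rfl
        · rw [eq_triple_of_mem hF3 hxF h hyF hxa hyx.symm hya.symm]
          simp [Y]
        · grind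
      by_cases hbF : b ∈ F
      · obtain ⟨w, hwb, hwy, rfl⟩ := exists_eq_triple hF3 hbF hyF hyb.symm
        have hwV := hsub _ hF (show w ∈ _ by simp)
        by_cases hwR : w ∈ R
        · refine mem_union_right _ (mem_image.2 ⟨w, by grind, ?_⟩)
          simp [e, hF]
        · refine mem_union_left _ ?_
          have hwx : w ≠ x := by rintro rfl; simp at hxF
          by_cases hwa : w = a
          · rw [eq_triple_of_mem hF3 (show a ∈ _ by simp [hwa]) hbF hyF hab hya.symm hyb.symm]
            simp [Y]
          by_cases hwc : w = c
          · rw [eq_triple_of_mem hF3 hbF (show c ∈ _ by simp [hwc]) hyF hbc hyb.symm hyc.symm]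
            simp [Y]
          exact absurd (hmemR w hwV hwx hwa hwb hwc) hwR
      have hcF := (hmeet F hF hxF).resolve_left hbF
      obtain ⟨w, hwc, hwy, rfl⟩ := exists_eq_triple hF3 hcF hyF hyc.symm
      have hwV := hsub _ hF (show w ∈ _ by simp)
      by_cases hwR : w ∈ R
      · refine mem_union_right _ (mem_image.2 ⟨w, by grind, ?_⟩)
        have : {b, y, w} ∉ 𝒻 := fun h ↦ hdisj y hy w hwR hwy.symm h hF
        simp [e, this]
      · refine mem_union_left _ ?_
        have hwx : w ≠ x := by rintro rfl; simp at hxF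
        have hwb : w ≠ b := by rintro rfl; simp at hbF
        by_cases hwa : w = a
        · rw [eq_triple_of_mem hF3 (show a ∈ _ by simp [hwa]) hcF hyF hac hya.symm hyc.symm]
          simp [Y]
        exact absurd (hmemR w hwV hwx hwa hwb hwc) hwR
    have hle : #(Y ∪ (R.erase y).image e) ≤ n - 1 := by
      have h₁ := card_union_le Y ((R.erase y).image e)
      have h₂ : #Y ≤ 4 := card_le_four
      have h₃ := card_image_le (s := R.erase y) (f := e)
      rw [card_erase_of_mem hy] at h₃
      omega
    have heq := eq_of_subset_of_card_le hss (hle.trans (hdeg y hyV))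
    have hmem : ∀ G ∈ Y ∪ (R.erase y).image e, G ∈ 𝒻 :=
      fun G hG ↦ (mem_filter.1 (heq ▸ hG)).1
    refine ⟨hmem _ (by simp [Y]), hmem _ (by simp [Y]), hmem _ (by simp [Y]), fun z hz hzy ↦ ?_⟩
    have := hmem (e z) (mem_union_right _ (mem_image_of_mem _ (by grind)))
    grind
  have hC : ∀ y ∈ R, ∀ z ∈ R, ∀ w ∈ R, y ≠ z → y ≠ w → z ≠ w →
      ¬ ({c, y, z} ∈ 𝒻 ∧ {c, z, w} ∈ 𝒻) ∧ ¬ ({b, y, z} ∈ 𝒻 ∧ {b, z, w} ∈ 𝒻) := by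
    intro y hy z hz w hw hyz hyw hzw
    obtain ⟨hyV, hyx, hya, hyb, hyc⟩ := hRmem y hy
    obtain ⟨hzV, hzx, hza, hzb, hzc⟩ := hRmem z hz
    obtain ⟨hwV, hwx, hwa, hwb, hwc⟩ := hRmem w hw
    constructor
    · rintro ⟨h₁, h₂⟩
      refine not_all_traces hns ha hb hyV hab hya.symm hyb.symm
        ⟨_, h₂, ?_⟩ ⟨_, hstar z hzV hzx hza, ?_⟩ ⟨_, (hfull z hz).2.2.1, ?_⟩ ⟨_, h₁, ?_⟩
        ⟨_, hstar b hb hxb.symm hab.symm, ?_⟩ ⟨_, hstar y hyV hyx hya, ?_⟩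
        ⟨_, (hfull y hy).2.2.1, ?_⟩ ⟨_, (hfull y hy).1, ?_⟩ <;>
      clear hns hdeg hsub hcard hlink hstar hmeet hRmem hmemR hdisj hfull h₁ h₂ <;> grind
    · rintro ⟨h₁, h₂⟩
      refine not_all_traces hns ha hc hyV hac hya.symm hyc.symm
        ⟨_, h₂, ?_⟩ ⟨_, hstar z hzV hzx hza, ?_⟩ ⟨_, (hfull z hz).2.2.1, ?_⟩ ⟨_, h₁, ?_⟩
        ⟨_, hstar c hc hxc.symm hac.symm, ?_⟩ ⟨_, hstar y hyV hyx hya, ?_⟩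
        ⟨_, (hfull y hy).2.2.1, ?_⟩ ⟨_, (hfull y hy).2.1, ?_⟩ <;>
      clear hns hdeg hsub hcard hlink hstar hmeet hRmem hmemR hdisj hfull h₁ h₂ <;> grind
  obtain ⟨u, hu, v, hv, w, hw, huv, huw, hvw⟩ := two_lt_card.1 (show 2 < #R by omega)
  have h₁ := (hfull u hu).2.2.2 v hv huv.symm
  have h₂ := (hfull v hv).2.2.2 w hw hvw.symm
  have h₃ := (hfull w hw).2.2.2 u hu huw
  have k₁ := hC u hu v hv w hw huv huw hvw
  have k₂ := hC v hv w hw u hu hvw huv.symm huw.symm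
  have k₃ := hC w hw u hu v hv huw.symm hvw.symm huv
  tauto

theorem succ_choose_two (k : ℕ) : (k + 1).choose 2 = k + k.choose 2 :=
  (Nat.choose_succ_succ' k 1).trans (by rw [Nat.choose_one_right])

theorem mem_of_double_star {V : Finset ℕ} {𝒻 : Finset (Finset ℕ)}
    (hns : ∀ S ⊆ V, #S = 3 → ¬ Shatters 𝒻 S)
    {x a b c d e : ℕ} (hx : x ∈ V) (ha : a ∈ V) (hb : b ∈ V) (hd : d ∈ V) (he : e ∈ V)
    (hxa : x ≠ a) (hxb : x ≠ b) (hxc : x ≠ c) (hab : a ≠ b) (hac : a ≠ c)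
    (hstar : ∀ y ∈ V, y ≠ x → y ≠ a → {x, a, y} ∈ 𝒻)
    (hstar' : ∀ y ∈ V, y ≠ b → y ≠ c → {b, c, y} ∈ 𝒻)
    (hdP : d ∉ ({x, a, b, c} : Finset ℕ)) (heP : e ∉ ({x, a, b, c} : Finset ℕ)) (hde : d ≠ e)
    {F G : Finset ℕ} (hF : F ∈ 𝒻) (haF : a ∈ F) (hdF : d ∈ F) (heF : e ∈ F) (hG : G ∈ 𝒻)
    (hdG : d ∈ G) (heG : e ∈ G) : a ∈ G := by
  by_contra haG
  simp only [mem_insert, mem_singleton, not_or] at hdP heP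
  obtain ⟨hdx, hda, hdb, hdc⟩ := hdP
  obtain ⟨hex, hea, heb, hec⟩ := heP
  refine not_all_traces hns ha hd he (Ne.symm hda) (Ne.symm hea) hde
    ⟨_, hstar' x hx hxb hxc, ?_⟩ ⟨_, hstar b hb hxb.symm hab.symm, ?_⟩
    ⟨_, hstar' d hd hdb hdc, ?_⟩ ⟨_, hstar' e he heb hec, ?_⟩
    ⟨_, hstar d hd hdx hda, ?_⟩ ⟨_, hstar e he hex hea, ?_⟩
    ⟨G, hG, haG, hdG, heG⟩ ⟨F, hF, haF, hdF, heF⟩ <;>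
    clear hns hstar hstar' <;> grind

set_option maxHeartbeats 1000000 in
theorem false_of_double_star {n : ℕ} (hn : 8 ≤ n) {V : Finset ℕ} (hV : #V = n)
    {𝒻 : Finset (Finset ℕ)} (hsub : ∀ F ∈ 𝒻, F ⊆ V) (hcard : ∀ F ∈ 𝒻, #F = 3)
    (hns : ∀ S ⊆ V, #S = 3 → ¬ Shatters 𝒻 S) (hbig : (n - 1).choose 2 + 2 ≤ #𝒻)
    {x a b c : ℕ} (hx : x ∈ V) (ha : a ∈ V) (hb : b ∈ V) (hc : c ∈ V) (hxa : x ≠ a)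
    (hxb : x ≠ b) (hxc : x ≠ c) (hab : a ≠ b) (hac : a ≠ c) (hbc : b ≠ c)
    (hdeg : #{F ∈ 𝒻 | x ∈ F} = n - 1)
    (hstar : ∀ y ∈ V, y ≠ x → y ≠ a → {x, a, y} ∈ 𝒻)
    (hstar' : ∀ y ∈ V, y ≠ b → y ≠ c → {b, c, y} ∈ 𝒻)
    (hno : ∀ F ∈ 𝒻, x ∉ F → b ∈ F → c ∈ F) : False := by
  obtain ⟨P, hP⟩ : ∃ P, P = V \ {x, a, b, c} := ⟨_, rfl⟩
  have hPmem : ∀ y, y ∈ P ↔ y ∈ V ∧ y ∉ ({x, a, b, c} : Finset ℕ) := by simp [hP]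
  have hPcard : #P = n - 4 := by
    rw [hP, card_sdiff_of_subset (by simp [insert_subset_iff, hx, ha, hb, hc]), hV,
      card_insert_of_notMem (by simp [hxa, hxb, hxc]),
      card_eq_three.2 ⟨a, b, c, hab, hac, hbc, rfl⟩]
  have hacm : ∀ d ∈ P, ∀ e ∈ P, d ≠ e → ∀ F ∈ 𝒻, d ∈ F → e ∈ F → ∀ G ∈ 𝒻, d ∈ G → e ∈ G →
      (a ∈ F → a ∈ G) ∧ (c ∈ F → c ∈ G) := by
    intro d hd e he hde F hF hdF heF G hG hdG heG
    rw [hPmem] at hd he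
    refine ⟨fun h ↦ mem_of_double_star hns hx ha hb hd.1 he.1 hxa hxb hxc hab hac hstar hstar'
      hd.2 he.2 hde hF h hdF heF hG hdG heG, fun h ↦ mem_of_double_star hns hb hc hx hd.1 he.1
      hbc hxb.symm hab.symm hxc.symm hac.symm hstar' hstar ?_ ?_ hde hF h hdF heF hG hdG heG⟩
    · have := hd.2; clear * - this; grind
    · have := he.2; clear * - this; grind
  let φ : Finset ℕ → Finset ℕ := fun F ↦ F \ {a, c}
  let B : Finset (Finset ℕ) := {F ∈ 𝒻 | x ∉ F ∧ b ∈ F}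
  let A : Finset (Finset ℕ) := {F ∈ 𝒻 | x ∉ F ∧ b ∉ F ∧ a ∈ F ∧ c ∈ F}
  let M : Finset (Finset ℕ) := {F ∈ 𝒻 | x ∉ F ∧ b ∉ F ∧ (a ∈ F ∧ c ∉ F ∨ a ∉ F ∧ c ∈ F)}
  let T : Finset (Finset ℕ) := {F ∈ 𝒻 | x ∉ F ∧ b ∉ F ∧ a ∉ F ∧ c ∉ F}
  let D : Finset (Finset ℕ) := {E ∈ powersetCard 2 P | ∃ F ∈ T, E ⊆ F}
  have hB : #B ≤ n - 3 := by
    have hss : B ⊆ (V \ {x, b, c}).image fun y ↦ ({b, c, y} : Finset ℕ) := by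
      intro F hF
      obtain ⟨hF, hxF, hbF⟩ := mem_filter.1 hF
      obtain ⟨y, hyb, hyc, rfl⟩ := exists_eq_triple (hcard F hF) hbF (hno F hF hxF hbF) hbc
      have hyV := hsub _ hF (show y ∈ _ by simp)
      refine mem_image.2 ⟨y, ?_, rfl⟩
      have : y ≠ x := by rintro rfl; simp at hxF
      simp [hyV, hyb, hyc, this]
    refine (card_le_card hss).trans (card_image_le.trans ?_)
    rw [card_sdiff_of_subset (by simp [insert_subset_iff, hx, hb, hc]), hV,
      card_eq_three.2 ⟨x, b, c, hxb, hxc, hbc, rfl⟩]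
  have hA : #A ≤ n - 4 := by
    have hss : A ⊆ P.image fun y ↦ ({a, c, y} : Finset ℕ) := by
      intro F hF
      obtain ⟨hF, hxF, hbF, haF, hcF⟩ := mem_filter.1 hF
      obtain ⟨y, hya, hyc, rfl⟩ := exists_eq_triple (hcard F hF) haF hcF hac
      have hyV := hsub _ hF (show y ∈ _ by simp)
      refine mem_image.2 ⟨y, ?_, rfl⟩
      have h1 : y ≠ x := by rintro rfl; simp at hxF
      have h2 : y ≠ b := by rintro rfl; simp at hbF
      simp [hPmem, hyV, hya, hyc, h1, h2]
    exact (card_le_card hss).trans (card_image_le.trans hPcard.le)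
  have hM : ∀ F ∈ M, ∃ d ∈ P, ∃ e ∈ P, d ≠ e ∧ φ F = {d, e} ∧
      (F = insert a (φ F) ∨ F = insert c (φ F)) := by
    intro F hF
    obtain ⟨hF, hxF, hbF, h⟩ := mem_filter.1 hF
    have h1 : #(φ F) = 2 := by
      have : #(F ∩ {a, c}) = 1 := by
        rw [card_eq_one]
        rcases h with h | h
        · exact ⟨a, by clear * - h; grind⟩
        · exact ⟨c, by clear * - h; grind⟩
      have h' := card_sdiff_add_card_inter F {a, c}
      rw [hcard F hF] at h'
      simp only [φ]
      omega
    obtain ⟨d, e, hde, h2⟩ := card_eq_two.1 h1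
    have hss : ∀ y ∈ φ F, y ∈ P := by
      intro y hy
      obtain ⟨hyF, hy⟩ := mem_sdiff.1 hy
      refine (hPmem y).2 ⟨hsub F hF hyF, ?_⟩
      clear * - hyF hy hxF hbF
      grind
    refine ⟨d, hss d (by simp [h2]), e, hss e (by simp [h2]), hde, h2, ?_⟩
    clear * - h
    rcases h with h | h
    · left; ext; grind
    · right; ext; grind
  have hinj : Set.InjOn φ M := by
    intro F hF G hG hFG
    obtain ⟨d, hd, e, he, hde, h1, h2⟩ := hM F hF
    obtain ⟨-, -, -, -, -, -, h3⟩ := hM G hG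
    obtain ⟨hF, -, -, hF'⟩ := mem_filter.1 hF
    obtain ⟨hG, -, -, hG'⟩ := mem_filter.1 hG
    have hsF : φ F ⊆ F := sdiff_subset
    have hsG : φ G ⊆ G := sdiff_subset
    have hdF : d ∈ F := hsF (by simp [h1])
    have heF : e ∈ F := hsF (by simp [h1])
    have hdG : d ∈ G := hsG (by simp [← hFG, h1])
    have heG : e ∈ G := hsG (by simp [← hFG, h1])
    have k1 := hacm d hd e he hde F hF hdF heF G hG hdG heG
    rw [← hFG] at h3
    have haF : F = insert a (φ F) → a ∈ F := fun h ↦ by rw [h]; simp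
    have hcF : F = insert c (φ F) → c ∈ F := fun h ↦ by rw [h]; simp
    have haG : G = insert a (φ F) → a ∈ G := fun h ↦ by rw [h]; simp
    have hcG : G = insert c (φ F) → c ∈ G := fun h ↦ by rw [h]; simp
    rcases h2 with h2 | h2 <;> rcases h3 with h3 | h3
    · exact h2.trans h3.symm
    · have := haF h2; have := hcG h3; tauto
    · have := hcF h2; have := haG h3; tauto
    · exact h2.trans h3.symm
  have hTD : #T ≤ #D := by
    refine card_le_card_of_not_shatters (fun F hF ↦ hcard F (mem_filter.1 hF).1) ?_ ?_
    · intro F hF E hE hE2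
      refine mem_filter.2 ⟨mem_powersetCard.2 ⟨fun y hy ↦ ?_, hE2⟩, F, hF, hE⟩
      obtain ⟨hF, h⟩ := mem_filter.1 hF
      have hyF := hE hy
      refine (hPmem y).2 ⟨hsub F hF hyF, ?_⟩
      clear * - hyF h
      grind
    · intro F hF hsh
      have hF := (mem_filter.1 hF).1
      refine hns F (hsub F hF) (hcard F hF) fun C hC ↦ ?_
      obtain ⟨G, hG, h⟩ := hsh C hC
      exact ⟨G, (mem_filter.1 hG).1, h⟩
  have hdisj : Disjoint (M.image φ) D := by
    rw [disjoint_left]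
    intro E hE hED
    obtain ⟨F, hF, rfl⟩ := mem_image.1 hE
    obtain ⟨-, G, hG, hFG⟩ := mem_filter.1 hED
    obtain ⟨d, hd, e, he, hde, h1, -⟩ := hM F hF
    obtain ⟨hF, -, -, hF'⟩ := mem_filter.1 hF
    obtain ⟨hG, -, -, hG'⟩ := mem_filter.1 hG
    have hsF : φ F ⊆ F := sdiff_subset
    have k1 := hacm d hd e he hde F hF (hsF (by simp [h1])) (hsF (by simp [h1]))
      G hG (hFG (by simp [h1])) (hFG (by simp [h1]))
    tauto
  have hMT : #M + #T ≤ (n - 4).choose 2 := by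
    have hss : M.image φ ∪ D ⊆ powersetCard 2 P := by
      refine union_subset (fun E hE ↦ ?_) (filter_subset _ _)
      obtain ⟨F, hF, rfl⟩ := mem_image.1 hE
      obtain ⟨d, hd, e, he, hde, h1, -⟩ := hM F hF
      rw [h1, mem_powersetCard]
      exact ⟨by simp [insert_subset_iff, hd, he], card_pair hde⟩
    have h := card_le_card hss
    rw [card_union_of_disjoint hdisj, card_image_of_injOn hinj, card_powersetCard, hPcard] at h
    omega
  have htot : #𝒻 ≤ #{F ∈ 𝒻 | x ∈ F} + #B + #A + #M + #T := by
    have hss : 𝒻 ⊆ {F ∈ 𝒻 | x ∈ F} ∪ B ∪ A ∪ M ∪ T := by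
      intro F hF
      simp only [B, A, M, T, mem_union, mem_filter, hF, true_and]
      tauto
    refine (card_le_card hss).trans ((card_union_le _ _).trans ?_)
    gcongr
    refine (card_union_le _ _).trans ?_
    gcongr
    refine (card_union_le _ _).trans ?_
    gcongr
    exact card_union_le _ _
  obtain ⟨m, rfl⟩ : ∃ m, n = m + 4 := ⟨n - 4, by omega⟩
  have hch : (m + 4 - 1).choose 2 = m.choose 2 + m + (m + 1) + (m + 2) := by
    rw [show m + 4 - 1 = m + 1 + 1 + 1 by omega, succ_choose_two, succ_choose_two, succ_choose_two]
    omega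
  rw [show m + 4 - 4 = m by omega] at hMT
  omega

theorem card_filter_notMem_le {n : ℕ} {V : Finset ℕ} (hV : #V = n) {𝒻 : Finset (Finset ℕ)}
    (hsub : ∀ F ∈ 𝒻, F ⊆ V) (hcard : ∀ F ∈ 𝒻, #F = 3)
    (hns : ∀ S ⊆ V, #S = 3 → ¬ Shatters 𝒻 S)
    (ih : ∀ (V : Finset ℕ) (𝒢 : Finset (Finset ℕ)), #V = n - 1 →
      (∀ G ∈ 𝒢, G ⊆ V) → (∀ G ∈ 𝒢, #G = 3) →
      (∀ S ⊆ V, #S = 3 → ¬ Shatters 𝒢 S) → #𝒢 ≤ (n - 2).choose 2 + 1)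
    {v : ℕ} (hv : v ∈ V) : #{F ∈ 𝒻 | v ∉ F} ≤ (n - 2).choose 2 + 1 := by
  refine ih (V.erase v) _ (by rw [card_erase_of_mem hv, hV]) (fun F hF ↦ ?_) (fun F hF ↦ ?_)
    fun S hS hS3 hsh ↦ ?_
  · exact subset_erase.2 ⟨hsub F (mem_filter.1 hF).1, (mem_filter.1 hF).2⟩
  · exact hcard F (mem_filter.1 hF).1
  · refine hns S (hS.trans (erase_subset _ _)) hS3 fun C hC ↦ ?_
    obtain ⟨G, hG, h⟩ := hsh C hC
    exact ⟨G, (mem_filter.1 hG).1, h⟩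

theorem not_shatters_insert {𝒻 𝒢 : Finset (Finset ℕ)} (hsub : 𝒢 ⊆ 𝒻) {K S : Finset ℕ}
    (hS : ¬ Shatters 𝒻 S) (hK : ∃ F ∈ 𝒻, F ∩ S = K ∩ S) : ¬ Shatters (insert K 𝒢) S := by
  intro h
  refine hS fun C hC ↦ ?_
  obtain ⟨G, hG, hGC⟩ := h C hC
  rcases mem_insert.1 hG with rfl | hG
  · obtain ⟨F, hF, hFK⟩ := hK
    exact ⟨F, hF, hFK.trans hGC⟩
  · exact ⟨G, hsub hG, hGC⟩

theorem false_of_two_witnesses {n : ℕ} (hn : 8 ≤ n) {V : Finset ℕ} (hV : #V = n)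
    {𝒻 : Finset (Finset ℕ)} (hsub : ∀ F ∈ 𝒻, F ⊆ V) (hcard : ∀ F ∈ 𝒻, #F = 3)
    (hns : ∀ S ⊆ V, #S = 3 → ¬ Shatters 𝒻 S) (hbig : (n - 1).choose 2 + 2 ≤ #𝒻)
    (ih : ∀ (V : Finset ℕ) (𝒢 : Finset (Finset ℕ)), #V = n - 1 →
      (∀ G ∈ 𝒢, G ⊆ V) → (∀ G ∈ 𝒢, #G = 3) →
      (∀ S ⊆ V, #S = 3 → ¬ Shatters 𝒢 S) → #𝒢 ≤ (n - 2).choose 2 + 1)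
    {x a b c : ℕ} (hx : x ∈ V) (ha : a ∈ V) (hb : b ∈ V) (hc : c ∈ V) (hxa : x ≠ a)
    (hxb : x ≠ b) (hxc : x ≠ c) (hab : a ≠ b) (hac : a ≠ c) (hbc : b ≠ c)
    (hmb : ∀ F ∈ 𝒻, x ∈ F → a ∈ F ∨ b ∈ F) (hmc : ∀ F ∈ 𝒻, x ∈ F → a ∈ F ∨ c ∈ F) : False := by
  have hch : (n - 1).choose 2 = (n - 2).choose 2 + (n - 2) := by
    obtain ⟨m, rfl⟩ : ∃ m, n = m + 2 := ⟨n - 2, by omega⟩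
    rw [show m + 2 - 1 = m + 1 by omega, show m + 2 - 2 = m by omega, succ_choose_two]
    omega
  have hdeg : ∀ v ∈ V, n - 1 ≤ #{F ∈ 𝒻 | v ∈ F} := by
    intro v hv
    have h1 := card_filter_notMem_le hV hsub hcard hns ih hv
    have h2 := card_filter_add_card_filter_not (s := 𝒻) (fun F ↦ v ∈ F)
    omega
  have hlink : ∀ F ∈ 𝒻, x ∈ F → a ∈ F ∨ F = {x, b, c} := by
    intro F hF hxF
    by_cases haF : a ∈ F
    · exact Or.inl haF
    · exact Or.inr (eq_triple_of_mem (hcard F hF) hxF ((hmb F hF hxF).resolve_left haF)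
        ((hmc F hF hxF).resolve_left haF) hxb hxc hbc)
  obtain ⟨hxbc, hstar, hdx⟩ := star_of_degree hV hsub hcard hx ha hxa (hdeg x hx) hlink
  obtain ⟨y, hyV, hy⟩ := exists_mem_notMem_of_card_lt_card (s := {x, a, b, c}) (t := V)
    (card_le_four.trans_lt (by omega))
  simp only [mem_insert, mem_singleton, not_or] at hy
  obtain ⟨hyx, hya, hyb, hyc⟩ := hy
  have htr : (∃ F ∈ 𝒻, x ∉ F ∧ b ∉ F ∧ c ∉ F) → (∃ F ∈ 𝒻, x ∉ F ∧ b ∈ F ∧ c ∉ F) →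
      (∃ F ∈ 𝒻, x ∉ F ∧ b ∉ F ∧ c ∈ F) → (∃ F ∈ 𝒻, x ∉ F ∧ b ∈ F ∧ c ∈ F) → False := by
    intro h₀ h₁ h₂ h₃
    refine not_all_traces hns hx hb hc hxb hxc hbc h₀ ⟨_, hstar y hyV hyx hya, ?_⟩ h₁ h₂
      ⟨_, hstar b hb hxb.symm hab.symm, ?_⟩ ⟨_, hstar c hc hxc.symm hac.symm, ?_⟩ h₃
      ⟨_, hxbc, ?_⟩ <;>
      clear hns hdeg hlink hstar hsub hcard ih hmb hmc h₀ h₁ h₂ h₃ <;> grind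
  have habc : {a, b, c} ∈ 𝒻 := by
    by_contra hnot
    have hle := ih (V.erase x) (insert {a, b, c} {F ∈ 𝒻 | x ∉ F})
      (by rw [card_erase_of_mem hx, hV]) ?_ ?_ ?_
    · rw [card_insert_of_notMem (fun h ↦ hnot (mem_filter.1 h).1)] at hle
      have h2 := card_filter_add_card_filter_not (s := 𝒻) (fun F ↦ x ∈ F)
      omega
    · intro G hG
      rcases mem_insert.1 hG with rfl | hG
      · simp [insert_subset_iff, ha, hb, hc, hxa.symm, hxb.symm, hxc.symm]
      · exact subset_erase.2 ⟨hsub G (mem_filter.1 hG).1, (mem_filter.1 hG).2⟩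
    · intro G hG
      rcases mem_insert.1 hG with rfl | hG
      · exact card_eq_three.2 ⟨a, b, c, hab, hac, hbc, rfl⟩
      · exact hcard G (mem_filter.1 hG).1
    · intro S hS hS3 hsh
      obtain ⟨hSV, hxS⟩ := subset_erase.1 hS
      by_cases hSeq : S = {a, b, c}
      · subst hSeq
        have key : ∀ C ⊆ ({b, c} : Finset ℕ),
            ∃ F ∈ 𝒻, x ∉ F ∧ (b ∈ F ↔ b ∈ C) ∧ (c ∈ F ↔ c ∈ C) := by
          intro C hC
          obtain ⟨G, hG, hGC⟩ := hsh C (hC.trans (subset_insert _ _))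
          have haC : a ∉ C := fun h ↦ by simpa [hab, hac] using hC h
          have hG' : ∀ u, u ∈ G ∧ u ∈ ({a, b, c} : Finset ℕ) ↔ u ∈ C := fun u ↦ by
            rw [← hGC, mem_inter]
          rcases mem_insert.1 hG with rfl | hG
          · exact absurd ((hG' a).1 (by simp)) haC
          · refine ⟨G, (mem_filter.1 hG).1, (mem_filter.1 hG).2, ?_, ?_⟩
            · simpa using hG' b
            · simpa using hG' c
        refine htr ?_ ?_ ?_ ?_
        · simpa using key ∅ (by simp)
        · simpa [hbc.symm] using key {b} (by simp)
        · simpa [hbc] using key {c} (by simp)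
        · simpa using key {b, c} subset_rfl
      · refine not_shatters_insert (filter_subset _ _) (hns S hSV hS3) ?_ hsh
        by_cases haS : a ∈ S
        · by_cases hbS : b ∈ S
          · refine ⟨_, hstar b hb hxb.symm hab.symm, ?_⟩
            have hcS : c ∉ S := fun h ↦ hSeq (eq_triple_of_mem hS3 haS hbS h hab hac hbc)
            clear * - hcS hxS
            ext; grind
          · by_cases hcS : c ∈ S
            · refine ⟨_, hstar c hc hxc.symm hac.symm, ?_⟩
              clear * - hbS hxS
              ext; grind
            · obtain ⟨z, hzV, hz⟩ := exists_mem_notMem_of_card_lt_card (s := insert x S) (t := V)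
                ((card_insert_le _ _).trans_lt (by omega))
              simp only [mem_insert, not_or] at hz
              refine ⟨_, hstar z hzV hz.1 (fun h ↦ hz.2 (h ▸ haS)), ?_⟩
              clear * - hbS hcS hxS hz
              ext; grind
        · refine ⟨_, hxbc, ?_⟩
          clear * - haS hxS
          ext; grind
  have hno : ∀ {b c : ℕ}, b ∈ V → c ∈ V → x ≠ b → x ≠ c → a ≠ b → a ≠ c → b ≠ c →
      (∀ F ∈ 𝒻, x ∈ F → a ∈ F ∨ F = {x, b, c}) → ¬ ∀ F ∈ 𝒻, x ∉ F → b ∈ F → c ∈ F := by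
    intro b c hb hc hxb hxc hab hac hbc hlink hno
    have hlinkb : ∀ F ∈ 𝒻, b ∈ F → c ∈ F ∨ F = {b, x, a} := by
      intro F hF hbF
      by_cases hxF : x ∈ F
      · rcases hlink F hF hxF with h | rfl
        · exact Or.inr (eq_triple_of_mem (hcard F hF) hbF hxF h hxb.symm hab.symm hxa)
        · simp
      · exact Or.inl (hno F hF hxF hbF)
    obtain ⟨-, hstar', -⟩ := star_of_degree hV hsub hcard hb hc hbc (hdeg b hb) hlinkb
    exact false_of_double_star hn hV hsub hcard hns hbig hx ha hb hc hxa hxb hxc hab hac hbc hdx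
      hstar hstar' hno
  by_cases h₁ : ∀ F ∈ 𝒻, x ∉ F → b ∈ F → c ∈ F
  · exact hno hb hc hxb hxc hab hac hbc hlink h₁
  by_cases h₂ : ∀ F ∈ 𝒻, x ∉ F → c ∈ F → b ∈ F
  · exact hno hc hb hxc hxb hac hab hbc.symm (fun F hF h ↦ pair_comm b c ▸ hlink F hF h) h₂
  push Not at h₁ h₂
  refine false_of_meets_pair hn hV hsub hcard hns hdeg hx ha hb hc hxa hxb hxc hab hac hbc hlink
    hstar fun F hF hxF ↦ ?_
  by_contra! h₀
  obtain ⟨G, hG, hxG, hcG, hbG⟩ := h₂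
  exact htr ⟨F, hF, hxF, h₀.1, h₀.2⟩ h₁ ⟨G, hG, hxG, hbG, hcG⟩
    ⟨_, habc, by simp [hxa, hxb, hxc], by simp, by simp⟩

/-- Under the inductive hypothesis and `|𝒻| ≥ C(n-1,2) + 2`, for every `x ∈ [n]` at most
one member of `𝒻` has witness `{x}`. -/
theorem stmt_10 (n : ℕ) (hn : 8 ≤ n) (𝒻 : Finset (Finset ℕ))
    (hsub : ∀ F ∈ 𝒻, F ⊆ Finset.Icc 1 n) (hcard : ∀ F ∈ 𝒻, F.card = 3)
    (hVC : ∀ S ⊆ Finset.Icc 1 n, S.card = 3 → ¬ Shatters 𝒻 S)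
    (hbig : (n - 1).choose 2 + 2 ≤ 𝒻.card)
    (ih : ∀ (V : Finset ℕ) (𝒢 : Finset (Finset ℕ)), V.card = n - 1 →
      (∀ G ∈ 𝒢, G ⊆ V) → (∀ G ∈ 𝒢, G.card = 3) →
      (∀ S ⊆ V, S.card = 3 → ¬ Shatters 𝒢 S) →
      𝒢.card ≤ (n - 2).choose 2 + 1)
    (W : Finset ℕ → Finset ℕ) (hW : MaximalWitness 𝒻 W) :
    ∀ x ∈ Finset.Icc 1 n, ∀ F₁ ∈ 𝒻, ∀ F₂ ∈ 𝒻,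
      W F₁ = {x} → W F₂ = {x} → F₁ = F₂ := by
  intro x hx F₁ hF₁ F₂ hF₂ hW₁ hW₂
  by_contra hne
  have hmeets : ∀ F ∈ 𝒻, W F = {x} → x ∈ F ∧ ∀ G ∈ 𝒻, x ∈ G → ∃ u ∈ F, u ∈ G ∧ u ≠ x := by
    intro F hF hWF
    obtain ⟨h1, h2, -⟩ := hW F hF
    rw [hWF] at h1 h2
    have hxF : x ∈ F := h1.1 (mem_singleton_self x)
    refine ⟨hxF, fun G hG hxG ↦ ?_⟩
    by_contra! h
    refine h2 G hG ?_
    ext u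
    have := h u
    clear * - this hxG hxF
    grind
  obtain ⟨hx₁, hm₁⟩ := hmeets F₁ hF₁ hW₁
  obtain ⟨hx₂, hm₂⟩ := hmeets F₂ hF₂ hW₂
  obtain ⟨a, ha₁, ha₂, hax⟩ := hm₁ F₂ hF₂ hx₂
  obtain ⟨b, hbx, hba, rfl⟩ := exists_eq_triple (hcard F₁ hF₁) hx₁ ha₁ hax.symm
  obtain ⟨c, hcx, hca, rfl⟩ := exists_eq_triple (hcard F₂ hF₂) hx₂ ha₂ hax.symm
  have hbc : b ≠ c := by rintro rfl; exact hne rfl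
  exact false_of_two_witnesses hn (by simp) hsub hcard hVC hbig ih hx (hsub _ hF₁ (by simp))
    (hsub _ hF₁ (by simp)) (hsub _ hF₂ (by simp)) hax.symm hbx.symm hcx.symm hba.symm hca.symm hbc
    (fun F hF hxF ↦ by simpa [hax, hbx] using hm₁ F hF hxF)
    (fun F hF hxF ↦ by simpa [hax, hcx] using hm₂ F hF hxF)
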